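/- Fix k ≥ 1 and ℓ ≥ 1, and set m = max(k,ℓ). For n ≥ 0 let a_n be the number of permutations of length n that avoid the classical pattern 1-3-2, begin with the pattern k(k-1)⋯1, and end with the pattern ℓ(ℓ-1)⋯1. Then in the ring of formal power series with integer coefficients, ∑_{n≥0} a_n x^n = x^{k+ℓ-1} · C(x)^{k+1} + ∑_{n=m}^{k+ℓ-2} x^n (the last sum being empty when m > k+ℓ-2). -/

import Mathlib

/-- `π` avoids the classical pattern 1-3-2: there are no indices `i < j < k`
with `π i < π k < π j`. -/
def AvoidsC132 {n : ℕ} (π : Equiv.Perm (Fin n)) : Prop :=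
  ¬ ∃ i j k : Fin n, i < j ∧ j < k ∧ π i < π k ∧ π k < π j

/-- `π` begins with the pattern `k(k-1)⋯1`: its first `k` letters are decreasing
(in particular the length is at least `k`). -/
def BeginsDec {n : ℕ} (π : Equiv.Perm (Fin n)) (k : ℕ) : Prop :=
  k ≤ n ∧ ∀ i j : Fin n, i < j → (j : ℕ) < k → π j < π i

/-- `π` ends with the pattern `ℓ(ℓ-1)⋯1`: its last `ℓ` letters are decreasing
(in particular the length is at least `ℓ`). -/
def EndsDec {n : ℕ} (π : Equiv.Perm (Fin n)) (l : ℕ) : Prop :=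
  l ≤ n ∧ ∀ i j : Fin n, i < j → n - l ≤ (i : ℕ) → π j < π i

/-- The number of permutations of length `n` avoiding the classical pattern 1-3-2,
beginning with `k(k-1)⋯1` and ending with `ℓ(ℓ-1)⋯1`. -/
noncomputable def a (k l n : ℕ) : ℕ :=
  Nat.card {π : Equiv.Perm (Fin n) // AvoidsC132 π ∧ BeginsDec π k ∧ EndsDec π l}

def ins {n : ℕ} (v : Fin (n+1)) (σ : Equiv.Perm (Fin n)) : Equiv.Perm (Fin (n+1)) :=
  (finSuccEquiv' 0).trans ((Equiv.optionCongr σ).trans (finSuccEquiv' v).symm)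

@[simp] lemma ins_zero {n : ℕ} (v : Fin (n+1)) (σ : Equiv.Perm (Fin n)) : ins v σ 0 = v := by
  simp [ins]

@[simp] lemma ins_succ {n : ℕ} (v : Fin (n+1)) (σ : Equiv.Perm (Fin n)) (i : Fin n) :
    ins v σ i.succ = v.succAbove (σ i) := by
  have : i.succ = (0 : Fin (n+1)).succAbove i := by simp
  rw [this]
  simp only [ins, Equiv.trans_apply, finSuccEquiv'_succAbove, Equiv.optionCongr_apply, Option.map_some, finSuccEquiv'_symm_some]

lemma ins_inj {n : ℕ} (v : Fin (n+1)) (σ τ : Equiv.Perm (Fin n)) (h : ins v σ = ins v τ) : σ = τ := by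
  ext i
  have := congrArg (fun f => f i.succ) h
  simp only [ins_succ] at this
  rw [Fin.succAbove_right_injective this]

lemma ins_surj {n : ℕ} (π : Equiv.Perm (Fin (n+1))) : ∃ σ, ins (π 0) σ = π := by
  let g : Option (Fin n) ≃ Option (Fin n) :=
    (finSuccEquiv' 0).symm.trans (π.trans (finSuccEquiv' (π 0)))
  have hg : g none = none := by simp [g]
  refine ⟨Equiv.removeNone g, ?_⟩
  have h2 : Equiv.optionCongr (Equiv.removeNone g) = g := by
    ext1 x
    cases x with
    | none => simp [hg]
    | some y => simp [Equiv.some_removeNone_iff, hg]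
  unfold ins
  rw [h2]
  ext i
  simp [g]

lemma ins_val {n : ℕ} (v : Fin (n+1)) (σ : Equiv.Perm (Fin n)) (i : Fin n) :
    ((ins v σ i.succ : Fin (n+1)) : ℕ) = if (σ i : ℕ) < v then (σ i : ℕ) else σ i + 1 := by
  rw [ins_succ]
  simp only [Fin.succAbove, Fin.lt_def, Fin.val_castSucc]
  split_ifs <;> simp

lemma ins_lt {n : ℕ} (v : Fin (n+1)) (σ : Equiv.Perm (Fin n)) (i j : Fin n) :
    ins v σ i.succ < ins v σ j.succ ↔ σ i < σ j := by
  rw [ins_succ, ins_succ, Fin.succAbove_lt_succAbove_iff]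

lemma ins_avoids {n : ℕ} (v : Fin (n+2)) (σ : Equiv.Perm (Fin (n+1))) :
    AvoidsC132 (ins v σ) ↔ AvoidsC132 σ ∧ (σ 0 : ℕ) < v + 1 := by
  constructor
  · intro h
    refine ⟨?_, ?_⟩
    · rintro ⟨i, j, k, hij, hjk, h1, h2⟩
      exact h ⟨i.succ, j.succ, k.succ, by simpa, by simpa, by rwa [ins_lt], by rwa [ins_lt]⟩
    · by_contra hc
      push Not at hc
      have hv : (v : ℕ) < n + 1 := by have := (σ 0).2; omega
      let w : Fin (n+1) := ⟨v, hv⟩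
      have hw : σ (σ.symm w) = w := by simp
      have hne : σ.symm w ≠ 0 := by
        intro h0
        rw [h0] at hw
        have := congrArg Fin.val hw
        simp [w] at this
        omega
      refine h ⟨0, (0 : Fin (n+1)).succ, (σ.symm w).succ, by simp [Fin.lt_def], ?_, ?_, ?_⟩
      · exact Fin.succ_lt_succ_iff.2 (Fin.pos_iff_ne_zero.2 hne)
      · rw [Fin.lt_def, ins_zero, ins_val, hw]
        simp [w]
      · rw [ins_lt, hw, Fin.lt_def]
        simp [w]; omega
  · rintro ⟨h, h0⟩ ⟨i, j, k, hij, hjk, h1, h2⟩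
    obtain ⟨k, rfl⟩ := Fin.exists_succ_eq.2 (Fin.ne_zero_of_lt hjk)
    obtain ⟨j, rfl⟩ := Fin.exists_succ_eq.2 (Fin.ne_zero_of_lt hij)
    rw [ins_lt] at h2
    rw [Fin.succ_lt_succ_iff] at hjk
    rcases Fin.eq_zero_or_eq_succ i with rfl | ⟨i, rfl⟩
    · rw [Fin.lt_def, ins_zero, ins_val] at h1
      have hk : (v : ℕ) ≤ σ k := by
        split_ifs at h1 <;> omega
      have hk0 : σ k ≠ σ 0 := fun e => (Fin.ne_zero_of_lt hjk) (σ.injective e)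
      have hlt : σ 0 < σ k := by
        rw [Fin.lt_def]
        have : (σ k : ℕ) ≠ σ 0 := fun e => hk0 (Fin.ext e)
        omega
      refine h ⟨0, j, k, ?_, hjk, hlt, h2⟩
      rw [Fin.pos_iff_ne_zero]
      rintro rfl
      exact absurd h2 (not_lt.2 hlt.le)
    · rw [ins_lt] at h1
      rw [Fin.succ_lt_succ_iff] at hij
      exact h ⟨i, j, k, hij, hjk, h1, h2⟩

lemma begins_one {n : ℕ} (σ : Equiv.Perm (Fin (n+1))) : BeginsDec σ 1 := by
  refine ⟨by omega, fun i j hij hj => ?_⟩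
  rw [Fin.lt_def] at hij; omega

lemma ins_begins {n k : ℕ} (hk : 1 ≤ k) (v : Fin (n+2)) (σ : Equiv.Perm (Fin (n+1))) :
    BeginsDec (ins v σ) (k+1) ↔ BeginsDec σ k ∧ (σ 0 : ℕ) < v := by
  constructor
  · rintro ⟨h1, h⟩
    refine ⟨⟨by omega, fun i j hij hj => ?_⟩, ?_⟩
    · have := h i.succ j.succ (by simpa) (by simpa)
      rwa [ins_lt] at this
    · have := h 0 (0 : Fin (n+1)).succ (by simp [Fin.lt_def]) (by simp; omega)
      rw [Fin.lt_def, ins_zero, ins_val] at this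
      split_ifs at this <;> omega
  · rintro ⟨⟨h1, h⟩, h0⟩
    refine ⟨by omega, fun i j hij hj => ?_⟩
    obtain ⟨j, rfl⟩ := Fin.exists_succ_eq.2 (Fin.ne_zero_of_lt hij)
    have hj' : (j : ℕ) < k := by simpa using hj
    rcases Fin.eq_zero_or_eq_succ i with rfl | ⟨i, rfl⟩
    · rw [Fin.lt_def, ins_zero, ins_val]
      have : (σ j : ℕ) ≤ σ 0 := by
        rcases eq_or_ne j 0 with rfl | hj0
        · rfl
        · exact (h 0 j (Fin.pos_iff_ne_zero.2 hj0) hj').le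
      rw [if_pos (by omega)]; omega
    · rw [ins_lt]
      exact h i j (by simpa using hij) hj'

lemma ins_ends {n l : ℕ} (hl : l ≤ n + 1) (v : Fin (n+2)) (σ : Equiv.Perm (Fin (n+1))) :
    EndsDec (ins v σ) l ↔ EndsDec σ l := by
  constructor
  · rintro ⟨h1, h⟩
    refine ⟨by omega, fun i j hij hj => ?_⟩
    have := h i.succ j.succ (by simpa) (by simp; omega)
    rwa [ins_lt] at this
  · rintro ⟨h1, h⟩
    refine ⟨by omega, fun i j hij hi => ?_⟩
    obtain ⟨j, rfl⟩ := Fin.exists_succ_eq.2 (Fin.ne_zero_of_lt hij)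
    rcases Fin.eq_zero_or_eq_succ i with rfl | ⟨i, rfl⟩
    · simp at hi; omega
    · rw [ins_lt]
      exact h i j (by simpa using hij) (by simp at hi; omega)

open Classical in
noncomputable def DD (k l n v : ℕ) : ℕ :=
  (Finset.univ.filter (fun π : Equiv.Perm (Fin (n+1)) =>
    (AvoidsC132 π ∧ BeginsDec π k ∧ EndsDec π l) ∧ (π 0 : ℕ) = v)).card

open Classical in
lemma a_eq (k l n : ℕ) : a k l (n+1) = ∑ v ∈ Finset.range (n+1), DD k l n v := by
  unfold a DD
  rw [Nat.card_eq_fintype_card, Fintype.card_subtype,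
    Finset.card_eq_sum_card_fiberwise (f := fun π : Equiv.Perm (Fin (n+1)) => (π 0 : ℕ))
      (t := Finset.range (n+1)) (fun π _ => Finset.mem_coe.2 (Finset.mem_range.2 (π 0).2))]
  simp only [Finset.filter_filter]

open Classical in
lemma DD_rec {n k k' l v w : ℕ} (hv : v ≤ n + 1)
    (h : ∀ σ : Equiv.Perm (Fin (n+1)), (AvoidsC132 (ins ⟨v, by omega⟩ σ) ∧ BeginsDec (ins ⟨v, by omega⟩ σ) k
      ∧ EndsDec (ins ⟨v, by omega⟩ σ) l) ↔ (AvoidsC132 σ ∧ BeginsDec σ k' ∧ EndsDec σ l) ∧ (σ 0 : ℕ) < w) :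
    DD k l (n+1) v = ∑ m ∈ Finset.range w, DD k' l n m := by
  have : ∑ m ∈ Finset.range w, DD k' l n m = (Finset.univ.filter (fun σ : Equiv.Perm (Fin (n+1)) =>
    (AvoidsC132 σ ∧ BeginsDec σ k' ∧ EndsDec σ l) ∧ (σ 0 : ℕ) < w)).card := by
    rw [Finset.card_eq_sum_card_fiberwise (f := fun π : Equiv.Perm (Fin (n+1)) => (π 0 : ℕ))
      (t := Finset.range w) (fun π hπ => by simpa using (by simpa using hπ : _ ∧ _).2)]
    refine Finset.sum_congr rfl fun m hm => ?_
    unfold DD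
    congr 1
    ext σ
    simp only [Finset.mem_filter, Finset.mem_univ, true_and, Finset.mem_range] at hm ⊢
    constructor
    · rintro ⟨h, rfl⟩; exact ⟨⟨h, hm⟩, rfl⟩
    · rintro ⟨⟨h, _⟩, rfl⟩; exact ⟨h, rfl⟩
  rw [this]
  symm
  unfold DD
  refine Finset.card_bij (fun σ _ => ins ⟨v, by omega⟩ σ) ?_ ?_ ?_
  · intro σ hσ
    simp only [Finset.mem_filter, Finset.mem_univ, true_and] at hσ ⊢
    exact ⟨(h σ).2 hσ, by rw [ins_zero]⟩
  · intro σ _ τ _ e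
    exact ins_inj _ _ _ e
  · intro π hπ
    simp only [Finset.mem_filter, Finset.mem_univ, true_and] at hπ
    obtain ⟨σ, hσ⟩ := ins_surj π
    have e : π 0 = ⟨v, by omega⟩ := Fin.ext hπ.2
    rw [e] at hσ
    refine ⟨σ, ?_, hσ⟩
    simp only [Finset.mem_filter, Finset.mem_univ, true_and]
    rw [← h, hσ]
    exact hπ.1

lemma DD_one {n l v : ℕ} (hl : l ≤ n + 1) (hv : v ≤ n + 1) :
    DD 1 l (n+1) v = ∑ m ∈ Finset.range (v+1), DD 1 l n m := by
  apply DD_rec hv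
  intro σ
  rw [ins_avoids, ins_ends hl]
  have := begins_one σ
  have := begins_one (ins ⟨v, by omega⟩ σ)
  tauto

lemma DD_succ {n k l v : ℕ} (hk : 1 ≤ k) (hl : l ≤ n + 1) (hv : v ≤ n + 1) :
    DD (k+1) l (n+1) v = ∑ m ∈ Finset.range v, DD k l n m := by
  apply DD_rec hv
  intro σ
  rw [ins_avoids, ins_ends hl, ins_begins hk]
  constructor
  · rintro ⟨⟨h1, _⟩, ⟨h2, h3⟩, h4⟩; exact ⟨⟨h1, h2, h4⟩, h3⟩
  · rintro ⟨⟨h1, h2, h4⟩, h3⟩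
    exact ⟨⟨h1, Nat.lt_succ_of_lt h3⟩, ⟨h2, h3⟩, h4⟩

lemma DD_big {n k l v : ℕ} (hv : n < v) : DD k l n v = 0 := by
  classical
  unfold DD
  rw [Finset.card_eq_zero, Finset.filter_eq_empty_iff]
  rintro π - ⟨-, h⟩
  have := (π 0).2
  omega

lemma DD_lt {n k l v : ℕ} (hk : n + 1 < k) : DD k l n v = 0 := by
  classical
  unfold DD
  rw [Finset.card_eq_zero, Finset.filter_eq_empty_iff]
  rintro π - ⟨⟨-, h, -⟩, -⟩
  have := h.1
  omega

lemma anti_unique {n : ℕ} (π : Equiv.Perm (Fin n)) (h : ∀ i j, i < j → π j < π i) :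
    π = Fin.revPerm := by
  have h1 : StrictMono (fun i => Fin.rev (π i)) := by
    intro i j hij
    simpa using h i j hij
  ext i
  have h2 : (fun i => Fin.rev (π i)) = id := (StrictMono.range_inj h1 strictMono_id).1 (by
    have : Function.Surjective (fun i => Fin.rev (π i)) := Fin.rev_surjective.comp π.surjective
    rw [this.range_eq]; simp)
  replace h2 := congrFun h2 i
  simp only [id] at h2
  have h3 := congrArg Fin.rev h2
  simp only [Fin.rev_rev] at h3
  rw [h3]; rfl

lemma rev_ok {n k l : ℕ} (hk : k ≤ n) (hl : l ≤ n) :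
    AvoidsC132 (Fin.revPerm : Equiv.Perm (Fin n)) ∧ BeginsDec (Fin.revPerm : Equiv.Perm (Fin n)) k ∧
    EndsDec (Fin.revPerm : Equiv.Perm (Fin n)) l := by
  refine ⟨?_, ⟨hk, fun i j h _ => by simpa⟩, ⟨hl, fun i j h _ => by simpa⟩⟩
  rintro ⟨i, j, k, h1, h2, h3, h4⟩
  simp at h3
  exact absurd (h1.trans h2) (not_lt.2 h3.le)

lemma a_self {k l : ℕ} (hl : l ≤ k) : a k l k = 1 := by
  unfold a
  rw [Nat.card_eq_one_iff_unique]
  refine ⟨⟨?_⟩, ⟨⟨Fin.revPerm, rev_ok le_rfl hl⟩⟩⟩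
  rintro ⟨x, hx⟩ ⟨y, hy⟩
  rw [Subtype.mk.injEq, anti_unique x (fun i j h => hx.2.1.2 i j h j.2),
    anti_unique y (fun i j h => hy.2.1.2 i j h j.2)]

lemma DD_base {k n v : ℕ} (hk : k ≤ n + 1) : DD k (n+1) n v = if v = n then 1 else 0 := by
  classical
  unfold DD
  have : ∀ π : Equiv.Perm (Fin (n+1)), ((AvoidsC132 π ∧ BeginsDec π k ∧ EndsDec π (n+1)) ∧ (π 0 : ℕ) = v)
      ↔ (π = Fin.revPerm ∧ v = n) := by
    intro π
    constructor
    · rintro ⟨⟨-, -, h⟩, h0⟩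
      have := anti_unique π (fun i j hh => h.2 i j hh (by omega))
      subst this
      simp at h0
      exact ⟨rfl, h0.symm⟩
    · rintro ⟨rfl, rfl⟩
      exact ⟨rev_ok hk le_rfl, by simp⟩
  simp only [this]
  split_ifs with h
  · simp [h, Finset.filter_eq']
  · simp [h]

lemma DD_shift0 {k l n : ℕ} (hk : 1 ≤ k) (hl : 1 ≤ l) (hkn : k ≤ n + 1) (hln : l ≤ n + 1) :
    DD k (l+1) (n+1) 0 = 0 := by
  induction n generalizing k with
  | zero =>
    obtain rfl : l = 1 := by omega
    rw [DD_base (by omega)]; simp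
  | succ n ih =>
    rcases Nat.lt_or_ge (n+1) l with h | h
    · obtain rfl : l = n + 1 + 1 := by omega
      rw [DD_base (by omega)]; simp
    · obtain ⟨k, rfl⟩ : ∃ k', k = k' + 1 := ⟨k - 1, by omega⟩
      rcases Nat.eq_zero_or_pos k with rfl | hk0
      · rw [zero_add, DD_one (by omega) (by omega)]
        simp [ih (k := 1) le_rfl (by omega) h]
      · rw [DD_succ hk0 (by omega) (by omega)]; simp

lemma DD_shift {k l n v : ℕ} (hk : 1 ≤ k) (hl : 1 ≤ l) (hkn : k ≤ n + 1) (hln : l ≤ n + 1) :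
    DD k (l+1) (n+1) (v+1) = DD k l n v := by
  induction n generalizing k v with
  | zero =>
    obtain rfl : l = 1 := by omega
    rw [DD_base (by omega), DD_base (n := 0) (by omega)]; simp
  | succ n ih =>
    rcases Nat.lt_or_ge (n+1) l with h | h
    · obtain rfl : l = n + 1 + 1 := by omega
      rw [DD_base (by omega), DD_base (by omega)]; simp
    · rcases Nat.lt_or_ge (n+1) v with hv | hv
      · rw [DD_big (by omega), DD_big (by omega)]
      obtain ⟨k, rfl⟩ : ∃ k', k = k' + 1 := ⟨k - 1, by omega⟩
      rcases Nat.eq_zero_or_pos k with rfl | hk0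
      · rw [zero_add, DD_one (by omega) (by omega), DD_one (by omega) (by omega),
          Finset.sum_range_succ', DD_shift0 le_rfl hl (by omega) h, add_zero]
        exact Finset.sum_congr rfl fun m _ => ih le_rfl (by omega) h
      · rw [DD_succ hk0 (by omega) (by omega), DD_succ hk0 (by omega) (by omega),
          Finset.sum_range_succ', DD_shift0 hk0 hl (by omega) h, add_zero]
        exact Finset.sum_congr rfl fun m _ => ih hk0 (by omega) h

lemma a_shift {k l n : ℕ} (hk : 1 ≤ k) (hl : 1 ≤ l) (hkn : k ≤ n + 1) (hln : l ≤ n + 1) :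
    a k (l+1) (n+2) = a k l (n+1) := by
  rw [a_eq, a_eq, Finset.sum_range_succ', DD_shift0 hk hl hkn hln, add_zero]
  exact Finset.sum_congr rfl fun m _ => DD_shift hk hl hkn hln

lemma E1 (n v : ℕ) : DD 1 1 (n+1) v = DD 2 1 (n+1) v + DD 1 1 n v := by
  rcases Nat.lt_or_ge (n+1) v with hv | hv
  · rw [DD_big hv, DD_big hv, DD_big (by omega)]
  · rw [DD_one (by omega) hv, DD_succ (k := 1) le_rfl (by omega) hv, Finset.sum_range_succ]

lemma E20 (k n : ℕ) : DD (k+2) 1 n 0 = 0 := by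
  cases n with
  | zero => exact DD_lt (by omega)
  | succ n => rw [DD_succ (by omega) (by omega) (by omega)]; simp

lemma E2 (k n v : ℕ) : DD (k+2) 1 (n+1) (v+1) = DD (k+3) 1 (n+1) (v+1) + DD (k+1) 1 n v := by
  induction k generalizing n v with
  | zero =>
    rcases Nat.lt_or_ge n v with hv | hv
    · rw [DD_big (by omega), DD_big (by omega), DD_big (by omega)]
    rw [zero_add, zero_add, DD_succ (k := 1) le_rfl (by omega) (by omega),
      DD_succ (k := 2) (by omega) (by omega) (by omega)]
    cases n with
    | zero =>
      obtain rfl : v = 0 := by omega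
      simp [DD_lt (n := 0) (k := 2)]
    | succ n =>
      rw [zero_add, DD_one (by omega) hv, ← Finset.sum_add_distrib]
      exact Finset.sum_congr rfl fun m _ => E1 n m
  | succ k ih =>
    rcases Nat.lt_or_ge n v with hv | hv
    · rw [DD_big (by omega), DD_big (by omega), DD_big (by omega)]
    rw [DD_succ (k := k+1+1) (by omega) (by omega) (by omega),
      DD_succ (k := k+1+2) (by omega) (by omega) (by omega)]
    cases n with
    | zero =>
      obtain rfl : v = 0 := by omega
      simp [DD_lt (n := 0)]
    | succ n =>
      rw [DD_succ (k := k+1) (by omega) (by omega) hv, Finset.sum_range_succ', Finset.sum_range_succ' _ v]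
      rw [E20, show k + 1 + 2 = (k+1) + 2 from rfl, E20, add_zero, add_zero, ← Finset.sum_add_distrib]
      exact Finset.sum_congr rfl fun m _ => ih n m

lemma W1 (n : ℕ) : a 1 1 (n+2) = a 2 1 (n+2) + a 1 1 (n+1) := by
  rw [a_eq, a_eq, a_eq]
  simp only [E1, Finset.sum_add_distrib]
  rw [Finset.sum_range_succ (fun v => DD 1 1 n v), DD_big (v := n+1) (by omega), add_zero]

lemma W2 (k n : ℕ) : a (k+2) 1 (n+2) = a (k+3) 1 (n+2) + a (k+1) 1 (n+1) := by
  rw [a_eq, a_eq, a_eq, Finset.sum_range_succ', Finset.sum_range_succ' (fun v => DD (k+3) 1 (n+1) v)]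
  rw [E20, E20, add_zero, add_zero, ← Finset.sum_add_distrib]
  exact Finset.sum_congr rfl fun m _ => E2 k n m

lemma a_lt {k l n : ℕ} (h : n < max k l) : a k l n = 0 := by
  unfold a
  rw [Nat.card_eq_zero]
  left
  refine ⟨?_⟩
  rintro ⟨π, -, h1, h2⟩
  have := h1.1
  have := h2.1
  omega

noncomputable def CC : PowerSeries ℤ := PowerSeries.mk fun n => (catalan n : ℤ)

lemma CC_eq : CC = CC ^ 2 * PowerSeries.X + 1 := by
  have h := congrArg (PowerSeries.map (Nat.castRingHom ℤ)) PowerSeries.catalanSeries_sq_mul_X_add_one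
  have e : PowerSeries.map (Nat.castRingHom ℤ) PowerSeries.catalanSeries = CC := by
    ext n; simp [CC]
  simp only [map_add, map_mul, map_pow, map_one, PowerSeries.map_X, e] at h
  exact h.symm

noncomputable def PP (k n : ℕ) : ℤ := PowerSeries.coeff n (PowerSeries.X ^ k * CC ^ (k+1))

lemma PP_lt {k n : ℕ} (h : n < k) : PP k n = 0 := by
  unfold PP
  rw [PowerSeries.coeff_X_pow_mul', if_neg (by omega)]

lemma PP_rec (k n : ℕ) : PP (k+1) (n+1) = PP (k+2) (n+1) + PP k n := by
  unfold PP
  rw [← PowerSeries.coeff_succ_X_mul n, ← map_add]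
  congr 1
  linear_combination (PowerSeries.X ^ (k+1) * CC ^ (k+1)) * CC_eq

lemma PP_zero (n : ℕ) : PP 0 n = PP 1 n + if n = 0 then 1 else 0 := by
  unfold PP
  rw [← PowerSeries.coeff_one, ← map_add]
  congr 1
  linear_combination CC_eq

lemma main1 (n k : ℕ) : (a (k+1) 1 n : ℤ) = PP (k+1) n := by
  induction n generalizing k with
  | zero => rw [a_lt (by omega), PP_lt (by omega)]; rfl
  | succ n ih =>
    obtain ⟨d, hd⟩ : ∃ d, n + 1 ≤ k + d := ⟨n + 1, by omega⟩
    induction d generalizing k with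
    | zero => rw [a_lt (by omega), PP_lt (by omega)]; rfl
    | succ d ihd =>
      rw [PP_rec, ← ihd (k+1) (by omega)]
      rcases n with _ | n
      · rcases k with _ | k
        · rw [zero_add, a_self le_rfl, a_lt (by omega), PP_zero, PP_lt (by omega)]; simp
        · rw [a_lt (by omega), a_lt (by omega), PP_lt (by omega)]; simp
      · rcases k with _ | k
        · rw [PP_zero, ← ih 0, if_neg (by omega), zero_add, W1]; push_cast; ring
        · rw [← ih k, W2]; push_cast; ring

lemma main2 (k l n : ℕ) (hk : 1 ≤ k) (hl : 1 ≤ l) (hkn : k ≤ n) (hln : l ≤ n) :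
    (a k l n : ℤ) = if k + l - 1 ≤ n then PP k (n + 1 - l) else 1 := by
  induction l, hl using Nat.le_induction generalizing n with
  | base =>
    rw [if_pos (by omega)]
    obtain ⟨k, rfl⟩ : ∃ k', k = k' + 1 := ⟨k - 1, by omega⟩
    rw [main1]; congr 1
  | succ l hl ih =>
    rcases hkn.eq_or_lt with rfl | h
    · rw [a_self hln, if_neg (by omega)]; rfl
    · obtain ⟨n, rfl⟩ : ∃ n', n = n' + 2 := ⟨n - 2, by omega⟩
      rw [a_shift hk hl (by omega) (by omega), ih (n+1) (by omega) (by omega)]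
      have e : n + 2 + 1 - (l + 1) = n + 1 + 1 - l := by omega
      rw [e]
      by_cases hc : k + l - 1 ≤ n + 1
      · rw [if_pos hc, if_pos (by omega)]
      · rw [if_neg hc, if_neg (by omega)]

theorem avoidC132_beginDec_endDec_gf (k l : ℕ) (hk : 1 ≤ k) (hl : 1 ≤ l) :
    PowerSeries.mk (fun n => (a k l n : ℤ))
      = PowerSeries.X ^ (k + l - 1) * (PowerSeries.mk fun n => (catalan n : ℤ)) ^ (k + 1)
        + ∑ n ∈ Finset.Icc (max k l) (k + l - 2), PowerSeries.X ^ n := by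
  ext n
  rw [PowerSeries.coeff_mk, map_add, map_sum]
  change _ = PowerSeries.coeff n (PowerSeries.X ^ (k + l - 1) * CC ^ (k + 1)) + _
  simp only [PowerSeries.coeff_X_pow, Finset.sum_ite_eq, Finset.mem_Icc]
  rw [PowerSeries.coeff_X_pow_mul']
  by_cases h : n < max k l
  · rw [a_lt h, if_neg (by omega), if_neg (by omega)]; rfl
  · rw [main2 k l n hk hl (by omega) (by omega)]
    by_cases hc : k + l - 1 ≤ n
    · rw [if_pos hc, if_pos hc, if_neg (by omega), add_zero]
      unfold PP
      rw [PowerSeries.coeff_X_pow_mul', if_pos (by omega)]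
      congr 2; omega
    · rw [if_neg hc, if_neg hc, if_pos (by omega), zero_add]
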